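/- arXiv:1008.1830 — 3 statements merged into one kernel-verified Lean document; each statement's English description precedes it below -/
import Mathlib

section
/- For every real number β and every complex number z with Re z > −β, one has ζ_{β,0}(z) = 2 q^{−β/2}(q^{−1}−q)^z · Σ_{j=0}^∞ C(z+j−1, j) · q^{β+2j+z}/(1−q^{β+2j+z})², the series on the right converging absolutely. -/
open Complex Real Filter Finset Topology

/-- The q-number `[x]_q = (q^x - q^{-x})/(q - q⁻¹)`. -/
noncomputable def qnum (q x : ℝ) : ℝ := (q ^ x - q ^ (-x)) / (q - q⁻¹)

/-- For a positive real `a` and `w : ℂ`, `a^w := exp(w · ln a)`. -/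
noncomputable def rcpow (a : ℝ) (w : ℂ) : ℂ := Complex.exp (w * (Real.log a : ℂ))

/-- The `(n,j)`-term of the q-zeta double series, corresponding to
`l = n + 1/2` and `k = j - n - 1/2`: `q^{βl+δk} · [l+1/2]_q^{-z}`. -/
noncomputable def qzetaTerm (q β δ : ℝ) (z : ℂ) (n j : ℕ) : ℂ :=
  ((q ^ (β * ((n : ℝ) + 1/2) + δ * ((j : ℝ) - (n : ℝ) - 1/2)) : ℝ) : ℂ) *
    rcpow (qnum q ((n : ℝ) + 1)) (-z)

/-- The q-zeta function `ζ_{β,δ}(z)` as a double series. -/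
noncomputable def qzeta (q β δ : ℝ) (z : ℂ) : ℂ :=
  ∑' n : ℕ, ∑ j ∈ Finset.range (2 * n + 2), qzetaTerm q β δ z n j

/-- The generalized binomial coefficient `C(z+j-1, j) = (1/j!)·∏_{i=0}^{j-1}(z+i)`. -/
noncomputable def binomC (z : ℂ) (j : ℕ) : ℂ :=
  (∏ i ∈ Finset.range j, (z + (i : ℂ))) / (Nat.factorial j : ℂ)

theorem norm_rcpow (a : ℝ) (w : ℂ) : ‖rcpow a w‖ = Real.exp (w.re * Real.log a) := by
  simp [rcpow, Complex.norm_exp]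

theorem rcpow_add (a : ℝ) (v w : ℂ) : rcpow a (v + w) = rcpow a v * rcpow a w := by
  simp [rcpow, add_mul, Complex.exp_add]

theorem rcpow_natCast {a : ℝ} (ha : 0 < a) (n : ℕ) : rcpow a n = (a : ℂ) ^ n := by
  rw [rcpow, Complex.exp_nat_mul, ← Complex.ofReal_exp, Real.exp_log ha]

theorem norm_rcpow_lt_one {q : ℝ} (hq0 : 0 < q) (hq1 : q < 1) {w : ℂ} (hw : 0 < w.re) :
    ‖rcpow q w‖ < 1 := by
  rw [norm_rcpow, Real.exp_lt_one_iff]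
  exact mul_neg_of_pos_of_neg hw (Real.log_neg hq0 hq1)

theorem binomC_eq_choose (z : ℂ) (j : ℕ) : binomC z j = Ring.choose (z + j - 1) j := by
  have hfact : (Nat.factorial j : ℂ) ≠ 0 := by exact_mod_cast Nat.factorial_ne_zero j
  have hprod : (ascPochhammer ℂ j).eval z = ∏ i ∈ Finset.range j, (z + (i : ℂ)) := by
    induction j with
    | zero => simp
    | succ k ih =>
      rw [ascPochhammer_succ_eval, Finset.prod_range_succ,
        ih (by exact_mod_cast Nat.factorial_ne_zero k)]
  have h := Ring.factorial_nsmul_multichoose_eq_ascPochhammer z j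
  rw [Polynomial.ascPochhammer_smeval_eq_eval, hprod, Ring.multichoose_eq, nsmul_eq_mul] at h
  rw [binomC, ← h, mul_div_cancel_left₀ _ hfact]

/-- The binomial series `(1 - x)^{-z} = ∑ C(z+j-1, j) x^j` on the unit disc. -/
theorem hasSum_binomC_mul_pow (z : ℂ) {x : ℂ} (hx : ‖x‖ < 1) :
    HasSum (fun j => binomC z j * x ^ j) (1 / (1 - x) ^ z) := by
  have hmem : x ∈ Metric.eball (0 : ℂ) 1 := by
    rw [← ENNReal.ofReal_one, Metric.eball_ofReal]
    simpa using hx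
  have h := (Complex.one_div_one_sub_cpow_hasFPowerSeriesOnBall_zero z).hasSum hmem
  simpa [binomC_eq_choose, mul_comm] using h

theorem summable_norm_binomC_mul_pow (z : ℂ) {x : ℂ} (hx : ‖x‖ < 1) :
    Summable (fun j => ‖binomC z j * x ^ j‖) :=
  (hasSum_binomC_mul_pow z hx).summable.norm

theorem log_qnum {q : ℝ} (hq0 : 0 < q) (hq1 : q < 1) {m : ℕ} (hm : m ≠ 0) :
    Real.log (qnum q m) =
      -(m * Real.log q) + Real.log (1 - (q ^ 2) ^ m) - Real.log (q⁻¹ - q) := by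
  have hinv : 0 < q⁻¹ - q := by
    have := (one_lt_inv₀ hq0).2 hq1
    linarith
  have hpow : 0 < 1 - (q ^ 2) ^ m :=
    sub_pos.2 (pow_lt_one₀ (by positivity) (by nlinarith) hm)
  have hqm : 0 < q ^ m := pow_pos hq0 m
  have hqnum : qnum q m = (q ^ m)⁻¹ * (1 - (q ^ 2) ^ m) / (q⁻¹ - q) := by
    rw [qnum, Real.rpow_neg hq0.le, Real.rpow_natCast, ← neg_sub q⁻¹ q, div_neg, ← neg_div,
      ← pow_mul, mul_comm 2 m, pow_mul]
    congr 1
    field_simp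
    ring
  rw [hqnum, Real.log_div (by positivity) hinv.ne', Real.log_mul (by positivity) hpow.ne',
    Real.log_inv, Real.log_pow]

theorem qzetaTerm_zero_eq {q : ℝ} (hq0 : 0 < q) (hq1 : q < 1) (β : ℝ) (z : ℂ) (n j : ℕ) :
    qzetaTerm q β 0 z n j = ((q ^ (-β / 2) : ℝ) : ℂ) * rcpow (q⁻¹ - q) z *
      (rcpow q (β + z) ^ (n + 1) * (1 / (1 - ((q : ℂ) ^ 2) ^ (n + 1)) ^ z)) := by
  have hpow : 0 < 1 - (q ^ 2) ^ (n + 1) :=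
    sub_pos.2 (pow_lt_one₀ (by positivity) (by nlinarith) n.succ_ne_zero)
  have hcast : (1 - ((q : ℂ) ^ 2) ^ (n + 1)) = ((1 - (q ^ 2) ^ (n + 1) : ℝ) : ℂ) := by
    push_cast; rfl
  have hlog := log_qnum hq0 hq1 n.succ_ne_zero
  rw [Nat.cast_succ] at hlog
  rw [hcast, one_div, ← Complex.cpow_neg, Complex.cpow_def_of_ne_zero
      (Complex.ofReal_ne_zero.2 hpow.ne'), ← Complex.ofReal_log hpow.le, qzetaTerm, rcpow, hlog,
    Real.rpow_def_of_pos hq0, Real.rpow_def_of_pos hq0, rcpow, rcpow, ← Complex.exp_nat_mul,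
    Complex.ofReal_exp, Complex.ofReal_exp]
  simp only [← Complex.exp_add]
  congr 1
  push_cast
  ring

theorem rcpow_add_two_mul {q : ℝ} (hq0 : 0 < q) (β : ℝ) (z : ℂ) (j : ℕ) :
    rcpow q (((β + 2 * (j : ℝ)) : ℝ) + z) = rcpow q (β + z) * ((q : ℂ) ^ 2) ^ j := by
  rw [← pow_mul, ← rcpow_natCast hq0, ← rcpow_add]
  congr 1
  push_cast
  ring

/-- The double family `C(z+j-1, j) · m · w^m · x^{jm}` is absolutely summable. -/
theorem summable_binomC_mul_geometric (z : ℂ) {w x : ℂ} (hw : ‖w‖ < 1) (hx : ‖x‖ < 1) :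
    Summable (fun p : ℕ × ℕ => binomC z p.1 * (p.2 * (w * x ^ p.1) ^ p.2)) := by
  have hgeom : Summable (fun m : ℕ => ‖(m : ℂ) * w ^ m‖) :=
    (hasSum_coe_mul_geometric_of_norm_lt_one hw).summable.norm
  refine Summable.of_norm_bounded ((summable_norm_binomC_mul_pow z hx).mul_of_nonneg hgeom
    (fun _ => norm_nonneg _) (fun _ => norm_nonneg _)) ?_
  rintro ⟨j, m⟩
  rcases eq_or_ne m 0 with rfl | hm
  · simp
  have hle : (‖x‖ ^ j) ^ m ≤ ‖x‖ ^ j :=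
    pow_le_of_le_one (by positivity) (pow_le_one₀ (norm_nonneg _) hx.le) hm
  simp only [norm_mul, norm_pow, mul_pow]
  calc ‖binomC z j‖ * (‖(m : ℂ)‖ * (‖w‖ ^ m * (‖x‖ ^ j) ^ m))
      ≤ ‖binomC z j‖ * (‖(m : ℂ)‖ * (‖w‖ ^ m * ‖x‖ ^ j)) := by gcongr
    _ = ‖binomC z j‖ * ‖x‖ ^ j * (‖(m : ℂ)‖ * ‖w‖ ^ m) := by ring

/-- Interchanging the order of summation in the double family. -/
theorem hasSum_binomC_mul_geometric (z : ℂ) {w x : ℂ} (hw : ‖w‖ < 1) (hx : ‖x‖ < 1) :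
    HasSum (fun j : ℕ => binomC z j * (w * x ^ j) / (1 - w * x ^ j) ^ 2)
      (∑' m : ℕ, (m : ℂ) * (w ^ m * (1 / (1 - x ^ m) ^ z))) := by
  have hs := summable_binomC_mul_geometric z hw hx
  have hrow : ∀ j : ℕ, HasSum (fun m : ℕ => binomC z j * (m * (w * x ^ j) ^ m))
      (binomC z j * (w * x ^ j) / (1 - w * x ^ j) ^ 2) := fun j => by
    have hj : ‖w * x ^ j‖ < 1 := by
      rw [norm_mul, norm_pow]
      exact mul_lt_one_of_nonneg_of_lt_one_left (norm_nonneg _) hw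
        (pow_le_one₀ (norm_nonneg _) hx.le)
    rw [mul_div_assoc]
    exact (hasSum_coe_mul_geometric_of_norm_lt_one hj).mul_left _
  have hcol : ∀ m : ℕ, HasSum (fun j : ℕ => binomC z j * (m * (w * x ^ j) ^ m))
      ((m : ℂ) * (w ^ m * (1 / (1 - x ^ m) ^ z))) := fun m => by
    rcases eq_or_ne m 0 with rfl | hm
    · simp
    have hm' : ‖x ^ m‖ < 1 := by
      rw [norm_pow]
      exact pow_lt_one₀ (norm_nonneg _) hx hm
    convert! (hasSum_binomC_mul_pow z hm').mul_left ((m : ℂ) * w ^ m) using 1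
    · funext j
      rw [mul_pow, ← pow_mul, ← pow_mul, mul_comm j m]
      ring
    · ring
  have hsum := hs.hasSum
  have hswap := ((Equiv.prodComm ℕ ℕ).hasSum_iff.2 hsum).prod_fiberwise hcol
  rw [hswap.tsum_eq]
  exact hsum.prod_fiberwise hrow

theorem tsum_eq_tsum_succ {f : ℕ → ℂ} (hf : f 0 = 0) : ∑' m, f m = ∑' n, f (n + 1) := by
  refine ((add_left_injective 1).tsum_eq fun m hm => ?_).symm
  exact ⟨m - 1, Nat.sub_one_add_one fun h : m = 0 => hm (h ▸ hf)⟩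

theorem statement2 (q : ℝ) (hq0 : 0 < q) (hq1 : q < 1) (β : ℝ) (z : ℂ)
    (hz : -β < z.re) :
    Summable (fun j : ℕ =>
      ‖binomC z j * rcpow q (((β + 2 * (j : ℝ)) : ℝ) + z) /
        (1 - rcpow q (((β + 2 * (j : ℝ)) : ℝ) + z)) ^ 2‖) ∧
    qzeta q β 0 z =
      ((2 * q ^ (-β / 2) : ℝ) : ℂ) * rcpow (q⁻¹ - q) z *
        ∑' j : ℕ, binomC z j * rcpow q (((β + 2 * (j : ℝ)) : ℝ) + z) /
          (1 - rcpow q (((β + 2 * (j : ℝ)) : ℝ) + z)) ^ 2 := by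
  have hw : ‖rcpow q (β + z)‖ < 1 :=
    norm_rcpow_lt_one hq0 hq1 (by simp only [Complex.add_re, Complex.ofReal_re]; linarith)
  have hx : ‖(q : ℂ) ^ 2‖ < 1 := by
    rw [norm_pow, Complex.norm_real, Real.norm_of_nonneg hq0.le]
    exact pow_lt_one₀ hq0.le hq1 two_ne_zero
  have h := hasSum_binomC_mul_geometric z hw hx
  simp only [rcpow_add_two_mul hq0]
  refine ⟨h.summable.norm, ?_⟩
  rw [h.tsum_eq, tsum_eq_tsum_succ (by simp), qzeta, ← tsum_mul_left]
  refine tsum_congr fun n => ?_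
  simp only [qzetaTerm_zero_eq hq0 hq1, Finset.sum_const, Finset.card_range, nsmul_eq_mul]
  push_cast
  ring
end

section
/- Let β, δ ∈ ℝ and let (t_{n,j})_{n∈ℕ, 0≤j≤2n+1} be any family of complex numbers that is uniformly bounded (there is C > 0 with |t_{n,j}| ≤ C for all n, j). Then for every z with Re z > −β + |δ| the series Σ_{n=0}^∞ Σ_{j=0}^{2n+1} t_{n,j} · q^{β(n+1/2)+δ(j−n−1/2)} · [n+1]_q^{−z} converges absolutely, and the function of z it defines is analytic (complex differentiable) on the open half-plane {z ∈ ℂ : Re z > −β + |δ|}. -/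
open Complex Real Filter Finset Topology

/-- Two-sided bound for the logarithm of a `q`-number: `ln [n+1]_q` differs from `-n ln q` by at
most `-ln (1 - q²)`. -/
lemma abs_log_qnum_sub_le {q : ℝ} (hq0 : 0 < q) (hq1 : q < 1) (n : ℕ) :
    |Real.log (qnum q ((n : ℝ) + 1)) - n * (-Real.log q)| ≤ -Real.log (1 - q ^ 2) := by
  have hq2 : 0 < 1 - q ^ 2 := by nlinarith
  have hpow : q ^ (2 * n + 2) ≤ q ^ 2 := pow_le_pow_of_le_one hq0.le hq1.le (by omega)
  have hpos : 0 < q ^ (2 * n + 2) := pow_pos hq0 _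
  have hnum : 0 < 1 - q ^ (2 * n + 2) := by linarith
  have hqnum : qnum q ((n : ℝ) + 1) = (q ^ n)⁻¹ * ((1 - q ^ (2 * n + 2)) / (1 - q ^ 2)) := by
    have hcast : ((n : ℝ) + 1) = ((n + 1 : ℕ) : ℝ) := by push_cast; ring
    have hden : q - q⁻¹ ≠ 0 := by
      have := one_lt_inv_iff₀.mpr ⟨hq0, hq1⟩
      linarith
    have hden' : q ^ 2 - 1 ≠ 0 := by linarith
    rw [qnum, Real.rpow_neg hq0.le, hcast, Real.rpow_natCast, div_eq_iff hden]
    field_simp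
    ring
  have hlog : Real.log (qnum q ((n : ℝ) + 1)) - n * (-Real.log q) =
      Real.log (1 - q ^ (2 * n + 2)) - Real.log (1 - q ^ 2) := by
    rw [hqnum, Real.log_mul (by positivity) (by positivity), Real.log_inv, Real.log_pow,
      Real.log_div hnum.ne' hq2.ne']
    ring
  have hlower : Real.log (1 - q ^ 2) ≤ Real.log (1 - q ^ (2 * n + 2)) :=
    Real.log_le_log hq2 (by linarith)
  have hupper : Real.log (1 - q ^ (2 * n + 2)) ≤ 0 := Real.log_nonpos hnum.le (by linarith)
  rw [hlog, abs_of_nonneg (by linarith)]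
  linarith

/-- Geometric bound for the terms of the double series, uniform on vertical strips. -/
lemma norm_qzetaTerm_le {q : ℝ} (hq0 : 0 < q) (hq1 : q < 1) (β δ : ℝ) {σ R : ℝ} {z : ℂ}
    (hσ : σ ≤ z.re) (hR : |z.re| ≤ R) {n j : ℕ} (hj : j ≤ 2 * n + 1) :
    ‖qzetaTerm q β δ z n j‖ ≤
      Real.exp (R * (-Real.log (1 - q ^ 2)) + Real.log q * (β - |δ|) / 2) *
        Real.exp (Real.log q * (β - |δ| + σ)) ^ n := by
  have hlogq : Real.log q < 0 := Real.log_neg hq0 hq1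
  have hbound := abs_log_qnum_sub_le hq0 hq1 n
  set a := Real.log (qnum q ((n : ℝ) + 1)) with ha
  rw [qzetaTerm, rcpow, norm_mul, Complex.norm_real, Complex.norm_exp,
    Real.norm_of_nonneg (Real.rpow_nonneg hq0.le _), Real.rpow_def_of_pos hq0, ← Real.exp_add,
    ← Real.exp_nat_mul, ← Real.exp_add, Real.exp_le_exp, Complex.re_mul_ofReal, Complex.neg_re]
  have hdiff : -z.re * (a - n * (-Real.log q)) ≤ R * (-Real.log (1 - q ^ 2)) :=
    calc -z.re * (a - n * (-Real.log q)) ≤ |-z.re * (a - n * (-Real.log q))| := le_abs_self _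
      _ = |z.re| * |a - n * (-Real.log q)| := by rw [abs_mul, abs_neg]
      _ ≤ R * (-Real.log (1 - q ^ 2)) :=
        mul_le_mul hR hbound (abs_nonneg _) ((abs_nonneg _).trans hR)
  have hj' : (j : ℝ) ≤ 2 * n + 1 := by exact_mod_cast hj
  have hk : |(j : ℝ) - n - 1 / 2| ≤ n + 1 / 2 := by
    rw [abs_le]
    constructor <;> linarith [(Nat.cast_nonneg j : (0 : ℝ) ≤ j)]
  have hδ : -(|δ| * (n + 1 / 2)) ≤ δ * ((j : ℝ) - n - 1 / 2) := by
    refine (neg_le_neg ?_).trans (neg_abs_le _)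
    rw [abs_mul]
    exact mul_le_mul_of_nonneg_left hk (abs_nonneg _)
  have hδq := mul_le_mul_of_nonpos_left hδ hlogq.le
  have hσq : (n : ℝ) * Real.log q * z.re ≤ n * Real.log q * σ :=
    mul_le_mul_of_nonpos_left hσ (mul_nonpos_of_nonneg_of_nonpos n.cast_nonneg hlogq.le)
  linarith

lemma summable_two_mul_add_two_mul_geometric {r : ℝ} (hr0 : 0 ≤ r) (hr1 : r < 1) (B : ℝ) :
    Summable fun n : ℕ => (2 * (n : ℝ) + 2) * (B * r ^ n) := by
  have hlin : Summable fun n : ℕ => (n : ℝ) ^ 1 * r ^ n :=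
    summable_pow_mul_geometric_of_norm_lt_one 1 (by rwa [Real.norm_of_nonneg hr0])
  have hgeom := summable_geometric_of_lt_one hr0 hr1
  refine ((hlin.mul_left (2 * B)).add (hgeom.mul_left (2 * B))).congr fun n => ?_
  ring

/-- A summable majorant of the double series, uniform on vertical strips. -/
lemma exists_summable_bound_qzetaTerm {q : ℝ} (hq0 : 0 < q) (hq1 : q < 1) (β δ : ℝ)
    {t : ℕ → ℕ → ℂ} {C : ℝ} (hC : 0 < C) (hbd : ∀ n j : ℕ, j ≤ 2 * n + 1 → ‖t n j‖ ≤ C)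
    {σ : ℝ} (hσ : -β + |δ| < σ) (R : ℝ) :
    ∃ u : ℕ → ℝ, Summable u ∧ ∀ (n : ℕ) (z : ℂ), σ ≤ z.re → |z.re| ≤ R →
      ∑ j ∈ Finset.range (2 * n + 2), ‖t n j * qzetaTerm q β δ z n j‖ ≤ u n := by
  have hr1 : Real.exp (Real.log q * (β - |δ| + σ)) < 1 :=
    Real.exp_lt_one_iff.mpr (mul_neg_of_neg_of_pos (Real.log_neg hq0 hq1) (by linarith))
  refine ⟨_, summable_two_mul_add_two_mul_geometric (Real.exp_pos _).le hr1
    (C * Real.exp (R * (-Real.log (1 - q ^ 2)) + Real.log q * (β - |δ|) / 2)),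
    fun n z hz hR => ?_⟩
  refine (Finset.sum_le_card_nsmul _ _
    (C * Real.exp (R * (-Real.log (1 - q ^ 2)) + Real.log q * (β - |δ|) / 2) *
      Real.exp (Real.log q * (β - |δ| + σ)) ^ n) fun j hj => ?_).trans_eq ?_
  · have hj' : j ≤ 2 * n + 1 := by
      have := Finset.mem_range.mp hj
      omega
    rw [norm_mul, mul_assoc]
    exact mul_le_mul (hbd n j hj') (norm_qzetaTerm_le hq0 hq1 β δ hz hR hj') (norm_nonneg _) hC.le
  · simp

lemma differentiable_qzetaTerm (q β δ : ℝ) (n j : ℕ) :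
    Differentiable ℂ fun z => qzetaTerm q β δ z n j := by
  unfold qzetaTerm rcpow
  fun_prop

theorem statement8 (q : ℝ) (hq0 : 0 < q) (hq1 : q < 1) (β δ : ℝ)
    (t : ℕ → ℕ → ℂ) (C : ℝ) (hC : 0 < C)
    (hbd : ∀ n j : ℕ, j ≤ 2 * n + 1 → ‖t n j‖ ≤ C) :
    (∀ z : ℂ, -β + |δ| < z.re →
      Summable (fun n : ℕ =>
        ∑ j ∈ Finset.range (2 * n + 2), ‖t n j * qzetaTerm q β δ z n j‖)) ∧
    DifferentiableOn ℂ
      (fun z : ℂ => ∑' n : ℕ, ∑ j ∈ Finset.range (2 * n + 2), t n j * qzetaTerm q β δ z n j)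
      {z : ℂ | -β + |δ| < z.re} := by
  refine ⟨fun z hz => ?_, fun z hz => ?_⟩
  · obtain ⟨u, hu, hle⟩ := exists_summable_bound_qzetaTerm hq0 hq1 β δ hC hbd hz |z.re|
    exact hu.of_nonneg_of_le (fun n => Finset.sum_nonneg fun _ _ => norm_nonneg _)
      fun n => hle n z le_rfl le_rfl
  · obtain ⟨σ, hσ, hσz⟩ := exists_between (show -β + |δ| < z.re from hz)
    obtain ⟨u, hu, hle⟩ := exists_summable_bound_qzetaTerm hq0 hq1 β δ hC hbd hσ (|z.re| + 1)
    have hopen : IsOpen {w : ℂ | σ < w.re ∧ |w.re| < |z.re| + 1} :=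
      (isOpen_lt continuous_const Complex.continuous_re).inter
        (isOpen_lt Complex.continuous_re.abs continuous_const)
    have hdiff := differentiableOn_tsum_of_summable_norm
      (F := fun n w => ∑ j ∈ Finset.range (2 * n + 2), t n j * qzetaTerm q β δ w n j) hu
      (fun n => (Differentiable.fun_sum fun j _ =>
        (differentiable_qzetaTerm q β δ n j).const_mul (t n j)).differentiableOn) hopen
      (fun n w hw => (norm_sum_le _ _).trans (hle n w hw.1.le hw.2.le))
    exact (hdiff.differentiableAt
      (hopen.mem_nhds ⟨hσz, lt_add_one _⟩)).differentiableWithinAt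
end

section
/- There exists a constant C > 0 such that for every half-integer l ∈ {1/2, 3/2, 5/2, …}, every k with k + l ∈ ℤ and |k| ≤ l, and every sign s ∈ {+1, −1}, one has q^{−l}·|(1+q²)^{−1}·(1 − α⁰₀(l,k)_s) − q^{2(l+k)}| ≤ C. (This is the boundedness statement underlying the decomposition A = M + A₀L of the Podleś sphere generator A, with A₀ a bounded operator.) -/
open Real

/-- The coefficient `α⁻₀(l,k)_s` of the Dąbrowski–Sitarz spectral triple. -/
noncomputable def alphaMinus (q l k s : ℝ) : ℝ :=
  q ^ (k + s / 2) * qnum q 2 * Real.sqrt (qnum q (l - k)) * Real.sqrt (qnum q (l + k)) *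
    Real.sqrt (qnum q (l - 1/2)) * Real.sqrt (qnum q (l + 1/2)) /
    (Real.sqrt (qnum q (2 * l - 1)) * qnum q (2 * l) * Real.sqrt (qnum q (2 * l + 1)))

/-- The coefficient `β_s(l)` of the Dąbrowski–Sitarz spectral triple. -/
noncomputable def betaCoef (q l s : ℝ) : ℝ :=
  (s * q ^ (-s) + (q - q⁻¹) * (qnum q (1/2) * qnum q (3/2) - qnum q l * qnum q (l + 1))) /
    (q * qnum q (2 * l + 2))

/-- The coefficient `α⁰₀(l,k)_s` of the Dąbrowski–Sitarz spectral triple. -/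
noncomputable def alphaZero (q l k s : ℝ) : ℝ :=
  (qnum q (2 * l))⁻¹ *
    (qnum q (l - k + 1) * qnum q (l + k) - q ^ 2 * qnum q (l - k) * qnum q (l + k + 1)) *
    betaCoef q l s

/-- The `k`-dependent factor of `alphaZero`, written in terms of `u = q^l` and `v = q^k`. -/
lemma qnum_factor_eq {q l : ℝ} (k : ℝ) (hq0 : 0 < q) (hq1 : q < 1) (hl : 0 < l) :
    (qnum q (2 * l))⁻¹ *
      (qnum q (l - k + 1) * qnum q (l + k) - q ^ 2 * qnum q (l - k) * qnum q (l + k + 1)) =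
    (1 - (1 + q ^ 2) * (q ^ l * q ^ k) ^ 2 + q ^ 2 * (q ^ l) ^ 4) / (1 - (q ^ l) ^ 4) := by
  have hu1 : q ^ l < 1 := rpow_lt_one hq0.le hq1 hl
  have hu0 : 0 < q ^ l := rpow_pos_of_pos hq0 l
  have hv0 : 0 < q ^ k := rpow_pos_of_pos hq0 k
  have h4 : 1 - (q ^ l) ^ 4 ≠ 0 := (sub_pos.2 (pow_lt_one₀ hu0.le hu1 (by norm_num))).ne'
  have hd : q ^ 2 - 1 ≠ 0 := (sub_neg.2 (pow_lt_one₀ hq0.le hq1 (by norm_num))).ne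
  have hq : q ≠ 0 := hq0.ne'
  have hd' : q - q⁻¹ ≠ 0 := by
    rw [show q - q⁻¹ = (q ^ 2 - 1) / q by field_simp]
    exact div_ne_zero hd hq
  simp only [qnum, rpow_neg hq0.le, two_mul, rpow_add hq0, rpow_sub hq0, rpow_one]
  generalize q ^ l = u at *
  generalize q ^ k = v at *
  have h4' : u * u - (u * u)⁻¹ ≠ 0 := by
    rw [show u * u - (u * u)⁻¹ = -(1 - u ^ 4) / (u * u) by field_simp; ring]
    exact div_ne_zero (neg_ne_zero.2 h4) (by positivity)
  rw [inv_div, eq_div_iff h4, div_mul_eq_mul_div, div_mul_eq_mul_div, div_eq_iff h4']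
  field_simp
  ring

/-- `betaCoef` written in terms of `u = q^l`. -/
lemma betaCoef_eq {q l : ℝ} (s : ℝ) (hq0 : 0 < q) (hq1 : q < 1) (hl : 0 < l) :
    betaCoef q l s =
    (1 + (q ^ l) ^ 2 * (q * ((q⁻¹ - q) * (s * q ^ (-s)) -
        (q⁻¹ - q) ^ 2 * (qnum q (1/2) * qnum q (3/2)) - (q + q⁻¹) + q * (q ^ l) ^ 2))) /
      (1 - q ^ 4 * (q ^ l) ^ 4) := by
  have hu1 : q ^ l < 1 := rpow_lt_one hq0.le hq1 hl
  have hu0 : 0 < q ^ l := rpow_pos_of_pos hq0 l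
  have h4 : 1 - q ^ 4 * (q ^ l) ^ 4 ≠ 0 := by
    rw [← mul_pow]
    exact (sub_pos.2 (pow_lt_one₀ (by positivity)
      (mul_lt_one_of_nonneg_of_lt_one_left hq0.le hq1 hu1.le) (by norm_num))).ne'
  have hd : q ^ 2 - 1 ≠ 0 := (sub_neg.2 (pow_lt_one₀ hq0.le hq1 (by norm_num))).ne
  have hq : q ≠ 0 := hq0.ne'
  have hd' : q - q⁻¹ ≠ 0 := by
    rw [show q - q⁻¹ = (q ^ 2 - 1) / q by field_simp]
    exact div_ne_zero hd hq
  unfold betaCoef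
  generalize qnum q (1/2) * qnum q (3/2) = c
  generalize s * q ^ (-s) = t
  rw [show 2 * l + 2 = l + l + (1 + 1) by ring]
  simp only [qnum, rpow_neg hq0.le, rpow_add hq0, rpow_one]
  generalize q ^ l = u at *
  have h4' : u * u * (q * q) - (u * u * (q * q))⁻¹ ≠ 0 := by
    rw [show u * u * (q * q) - (u * u * (q * q))⁻¹ =
      -(1 - q ^ 4 * u ^ 4) / (u * u * (q * q)) by field_simp; ring]
    exact div_ne_zero (neg_ne_zero.2 h4) (by positivity)
  rw [eq_div_iff h4, div_mul_eq_mul_div, div_eq_iff (mul_ne_zero hq (div_ne_zero h4' hd'))]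
  field_simp
  ring

/-- Perturbation estimate: multiplying `P + O(u⁴)` by `1 + O(u²)` and dividing by
`(1 - u⁴)(1 - q⁴u⁴)` changes `P` by `O(u²)`. -/
lemma abs_sub_perturbed_le {q u P E K : ℝ} (hq0 : 0 < q) (hq1 : q < 1) (hu0 : 0 < u)
    (hu : u ^ 4 ≤ q ^ 2) (hP : |P| ≤ 2) (hE : |E| ≤ K) :
    |P - (P + q ^ 2 * u ^ 4) / (1 - u ^ 4) * ((1 + u ^ 2 * E) / (1 - q ^ 4 * u ^ 4))| ≤
      u ^ 2 * ((5 + 3 * K) / (1 - q ^ 2) ^ 2) := by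
  have hq2 : q ^ 2 < 1 := pow_lt_one₀ hq0.le hq1 (by norm_num)
  have hq4 : q ^ 4 < 1 := pow_lt_one₀ hq0.le hq1 (by norm_num)
  have hK : 0 ≤ K := (abs_nonneg E).trans hE
  have hu4 : 0 < u ^ 4 := by positivity
  have hu2 : u ^ 2 ≤ 1 := by nlinarith [sq_nonneg (u ^ 2)]
  have hu42 : u ^ 4 ≤ u ^ 2 := by nlinarith [sq_nonneg u]
  have hqu : q ^ 4 * u ^ 4 ≤ u ^ 4 := mul_le_of_le_one_left hu4.le hq4.le
  have hqu0 : 0 < q ^ 4 * u ^ 4 := by positivity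
  have h1 : 1 - q ^ 2 ≤ 1 - u ^ 4 := by linarith
  have h2 : 1 - q ^ 2 ≤ 1 - q ^ 4 * u ^ 4 := by linarith
  have h0 : 0 < 1 - q ^ 2 := by linarith
  have hD : (1 - q ^ 2) ^ 2 ≤ (1 - u ^ 4) * (1 - q ^ 4 * u ^ 4) := by
    rw [sq]; exact mul_le_mul h1 h2 h0.le (h0.le.trans h1)
  have hD1 : |(1 - u ^ 4) * (1 - q ^ 4 * u ^ 4) - 1| ≤ 2 * u ^ 2 := by
    rw [abs_le]; constructor <;> nlinarith [mul_pos hu4 hqu0]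
  have hD0 : 0 < (1 - u ^ 4) * (1 - q ^ 4 * u ^ 4) := (pow_pos h0 2).trans_le hD
  have key : P - (P + q ^ 2 * u ^ 4) / (1 - u ^ 4) * ((1 + u ^ 2 * E) / (1 - q ^ 4 * u ^ 4)) =
      (P * ((1 - u ^ 4) * (1 - q ^ 4 * u ^ 4) - 1) - q ^ 2 * u ^ 4 * (1 + u ^ 2 * E)
        - P * (u ^ 2 * E)) / ((1 - u ^ 4) * (1 - q ^ 4 * u ^ 4)) := by
    rw [div_mul_div_comm, eq_div_iff hD0.ne', sub_mul, div_mul_cancel₀ _ hD0.ne']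
    ring
  rw [key, abs_div, abs_of_pos hD0, ← mul_div_assoc]
  refine div_le_div₀ (by positivity) ?_ (by positivity) hD
  have e1 : |u ^ 2 * E| ≤ u ^ 2 * K := by
    rw [abs_mul, abs_of_nonneg (sq_nonneg u)]; gcongr
  have e2 : |1 + u ^ 2 * E| ≤ 1 + K := by
    refine (abs_add_le _ _).trans ?_
    rw [abs_one]
    nlinarith
  have e3 : |q ^ 2 * u ^ 4 * (1 + u ^ 2 * E)| ≤ u ^ 2 * (1 + K) := by
    rw [abs_mul, abs_of_nonneg (by positivity)]
    refine mul_le_mul ?_ e2 (abs_nonneg _) (sq_nonneg u)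
    nlinarith
  have e4 : |P * ((1 - u ^ 4) * (1 - q ^ 4 * u ^ 4) - 1)| ≤ 2 * (2 * u ^ 2) := by
    rw [abs_mul]; gcongr
  have e5 : |P * (u ^ 2 * E)| ≤ 2 * (u ^ 2 * K) := by
    rw [abs_mul]; gcongr
  have := abs_sub (P * ((1 - u ^ 4) * (1 - q ^ 4 * u ^ 4) - 1) - q ^ 2 * u ^ 4 * (1 + u ^ 2 * E))
    (P * (u ^ 2 * E))
  have := abs_sub (P * ((1 - u ^ 4) * (1 - q ^ 4 * u ^ 4) - 1)) (q ^ 2 * u ^ 4 * (1 + u ^ 2 * E))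
  linarith

theorem statement14 (q : ℝ) (hq0 : 0 < q) (hq1 : q < 1) :
    ∃ C : ℝ, 0 < C ∧ ∀ (n : ℕ) (k s : ℝ),
      (∃ m : ℤ, k + ((n : ℝ) + 1/2) = (m : ℝ)) → |k| ≤ (n : ℝ) + 1/2 →
      (s = 1 ∨ s = -1) →
      q ^ (-((n : ℝ) + 1/2)) *
        |(1 + q ^ 2)⁻¹ * (1 - alphaZero q ((n : ℝ) + 1/2) k s) -
          q ^ (2 * (((n : ℝ) + 1/2) + k))| ≤ C := by
  have hq2 : q ^ 2 < 1 := pow_lt_one₀ hq0.le hq1 (by norm_num)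
  have hinv : q ≤ q⁻¹ := hq1.le.trans (one_lt_inv₀ hq0 |>.2 hq1).le
  have hd : 0 ≤ q⁻¹ - q := sub_nonneg.2 hinv
  obtain ⟨c, hc⟩ : ∃ c, c = qnum q (1/2) * qnum q (3/2) := ⟨_, rfl⟩
  obtain ⟨K, hKdef⟩ : ∃ K, K = q * ((q⁻¹ - q) * q⁻¹ + (q⁻¹ - q) ^ 2 * |c| + (q + q⁻¹) + q) :=
    ⟨_, rfl⟩
  have hK : 0 ≤ K := by rw [hKdef]; positivity
  have h0 : 0 < 1 - q ^ 2 := by linarith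
  refine ⟨(5 + 3 * K) / (1 - q ^ 2) ^ 2, by positivity, ?_⟩
  intro n k s _ hk hs
  have hn : (0 : ℝ) ≤ n := n.cast_nonneg
  obtain ⟨l, hl⟩ : ∃ l : ℝ, l = (n : ℝ) + 1/2 := ⟨_, rfl⟩
  rw [← hl] at hk ⊢
  have hl2 : 1/2 ≤ l := by linarith
  have hl0 : 0 < l := by linarith
  have ht : |s * q ^ (-s)| ≤ q⁻¹ := by
    rcases hs with rfl | rfl
    · rw [one_mul, rpow_neg_one, abs_of_pos (by positivity)]
    · rw [neg_neg, rpow_one, neg_one_mul, abs_neg, abs_of_pos hq0]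
      exact hinv
  have hu0 : 0 < q ^ l := rpow_pos_of_pos hq0 l
  have hu1 : q ^ l < 1 := rpow_lt_one hq0.le hq1 hl0
  have hu4 : (q ^ l) ^ 4 ≤ q ^ 2 := by
    rw [← rpow_natCast, ← rpow_natCast, ← rpow_mul hq0.le]
    exact rpow_le_rpow_of_exponent_ge hq0 hq1.le (by push_cast; linarith)
  have hw : q ^ (2 * (l + k)) = (q ^ l * q ^ k) ^ 2 := by
    rw [two_mul, rpow_add hq0, rpow_add hq0, sq]
  have hw1 : (q ^ l * q ^ k) ^ 2 ≤ 1 := by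
    rw [← hw]
    exact rpow_le_one hq0.le hq1.le (by linarith [(abs_le.1 hk).1])
  rw [hw, alphaZero, qnum_factor_eq k hq0 hq1 hl0, betaCoef_eq s hq0 hq1 hl0, ← hc,
    rpow_neg hq0.le]
  generalize q ^ l = u at *
  generalize q ^ k = v at *
  generalize s * q ^ (-s) = t at *
  have hw0 : 0 ≤ (u * v) ^ 2 := sq_nonneg _
  generalize (u * v) ^ 2 = w at *
  have hE : |q * ((q⁻¹ - q) * t - (q⁻¹ - q) ^ 2 * c - (q + q⁻¹) + q * u ^ 2)| ≤ K := by
    rw [hKdef, abs_mul, abs_of_pos hq0]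
    gcongr
    have a1 : |(q⁻¹ - q) * t| ≤ (q⁻¹ - q) * q⁻¹ := by
      rw [abs_mul, abs_of_nonneg hd]; gcongr
    have a2 : |(q⁻¹ - q) ^ 2 * c| = (q⁻¹ - q) ^ 2 * |c| := by
      rw [abs_mul, abs_of_nonneg (sq_nonneg _)]
    have a3 : q * u ^ 2 ≤ q := mul_le_of_le_one_right hq0.le (pow_le_one₀ hu0.le hu1.le)
    have a4 : 0 ≤ q * u ^ 2 := by positivity
    have a5 : 0 < q⁻¹ := by positivity
    have a6 := abs_le.1 a1
    have a7 := abs_le.1 a2.le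
    rw [abs_le]
    constructor <;> linarith
  have hP : |1 - (1 + q ^ 2) * w| ≤ 2 := by
    rw [abs_le]; constructor <;> nlinarith
  have main := abs_sub_perturbed_le hq0 hq1 hu0 hu4 hP hE
  generalize (1 - (1 + q ^ 2) * w + q ^ 2 * u ^ 4) / (1 - u ^ 4) *
    ((1 + u ^ 2 * (q * ((q⁻¹ - q) * t - (q⁻¹ - q) ^ 2 * c - (q + q⁻¹) + q * u ^ 2))) /
      (1 - q ^ 4 * u ^ 4)) = a at *
  have hC : 0 ≤ (5 + 3 * K) / (1 - q ^ 2) ^ 2 := by positivity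
  generalize (5 + 3 * K) / (1 - q ^ 2) ^ 2 = C at *
  have hfac : (1 + q ^ 2)⁻¹ * (1 - a) - w = (1 + q ^ 2)⁻¹ * (1 - (1 + q ^ 2) * w - a) := by
    field_simp
    ring
  have hinv1 : (1 + q ^ 2)⁻¹ ≤ 1 := inv_le_one_of_one_le₀ (by linarith [sq_nonneg q])
  rw [hfac, abs_mul, abs_of_pos (by positivity : 0 < (1 + q ^ 2)⁻¹), inv_mul_le_iff₀ hu0]
  calc (1 + q ^ 2)⁻¹ * |1 - (1 + q ^ 2) * w - a|
      ≤ |1 - (1 + q ^ 2) * w - a| := mul_le_of_le_one_left (abs_nonneg _) hinv1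
    _ ≤ u ^ 2 * C := main
    _ ≤ u * C := by gcongr; nlinarith
end
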